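/- Let γ > 0, α > −1, 1 < q < ∞, and 1 < p < ∞. There exists a constant C > 0, depending only on γ, q, α, p, n, such that for every f ∈ A^p_α: ‖A_γ^{(q)}(Rf)‖_{L^p(dv_α)} ≤ C ‖f‖_{p,α}, ‖A_γ^{(q)}(∇f)‖_{L^p(dv_α)} ≤ C ‖f‖_{p,α}, and ‖A_γ^{(q)}(∇̃f)‖_{L^p(dv_α)} ≤ C ‖f‖_{p,α}. -/

import Mathlib

open MeasureTheory Filter Topology
open scoped Classical ENNReal

noncomputable section

/-- `ℂⁿ` with the Euclidean norm. -/
abbrev En (n : ℕ) := EuclideanSpace ℂ (Fin n)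

instance (n : ℕ) : MeasurableSpace (En n) := borel _
instance (n : ℕ) : BorelSpace (En n) := ⟨rfl⟩

/-- The Lebesgue volume measure on `ℂⁿ`. -/
def vol (n : ℕ) : Measure (En n) := Measure.addHaar

/-- The open unit ball `𝔹ₙ` of `ℂⁿ`. -/
def uball (n : ℕ) : Set (En n) := Metric.ball 0 1

/-- The Hermitian pairing `⟨z,w⟩ = ∑ⱼ zⱼ * conj wⱼ`. -/
def herm {n : ℕ} (z w : En n) : ℂ := ∑ j, z j * (starRingEnd ℂ) (w j)

/-- The orthogonal projection `P_z w` onto the line spanned by `z`. -/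
def prj {n : ℕ} (z w : En n) : En n :=
  if z = 0 then 0 else (herm w z / herm z z) • z

/-- The Möbius automorphism `φ_z` of the unit ball. -/
def mobius {n : ℕ} (z w : En n) : En n :=
  ((1 : ℂ) / (1 - herm w z)) •
    (z - prj z w - ((Real.sqrt (1 - ‖z‖ ^ 2) : ℝ) : ℂ) • (w - prj z w))

/-- The Bergman metric `β(z,w)`. -/
def bmet {n : ℕ} (z w : En n) : ℝ :=
  (1 / 2) * Real.log ((1 + ‖mobius z w‖) / (1 - ‖mobius z w‖))

/-- The Bergman metric ball `D(z,γ)`. -/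
def Dball {n : ℕ} (z : En n) (γ : ℝ) : Set (En n) :=
  {w | w ∈ uball n ∧ bmet z w < γ}

/-- The normalizing constant `c_α`. -/
def cnorm (n : ℕ) (α : ℝ) : ℝ :=
  if -1 < α then Real.Gamma (n + α + 1) / (n.factorial * Real.Gamma (α + 1)) else 1

/-- The weighted measure `dv_α = c_α (1-|z|²)^α dv` on the unit ball. -/
def measA (n : ℕ) (α : ℝ) : Measure (En n) :=
  ((vol n).restrict (uball n)).withDensity
    (fun z => ENNReal.ofReal (cnorm n α * (1 - ‖z‖ ^ 2) ^ α))

/-- The invariant measure `dτ = (1-|z|²)^{-(n+1)} dv` on the unit ball. -/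
def measTau (n : ℕ) : Measure (En n) :=
  ((vol n).restrict (uball n)).withDensity
    (fun z => ENNReal.ofReal ((1 - ‖z‖ ^ 2) ^ (-((n : ℝ) + 1))))

/-- The Bergman space (quasi-)norm `‖f‖_{p,α}`, valued in `ℝ≥0∞`. -/
def apnorm (n : ℕ) (p α : ℝ) (f : En n → ℂ) : ℝ≥0∞ :=
  (∫⁻ z, ENNReal.ofReal (‖f z‖ ^ p) ∂measA n α) ^ (1 / p)

/-- The radial derivative `Rf(z) = ∑ z_k ∂f/∂z_k = Df(z)[z]`. -/
def radD {n : ℕ} (f : En n → ℂ) (z : En n) : ℂ := fderiv ℂ f z z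

/-- Iterated radial derivative `R^k f`. -/
def radIter {n : ℕ} : ℕ → (En n → ℂ) → En n → ℂ
  | 0, f => f
  | (k + 1), f => radD (radIter k f)

/-- The pseudo-metric `ϱ` on the unit ball. -/
def rho {n : ℕ} (z w : En n) : ℝ :=
  if z ≠ 0 ∧ w ≠ 0 then
    |‖z‖ - ‖w‖| + ‖1 - herm z w / ((‖z‖ : ℂ) * (‖w‖ : ℂ))‖
  else ‖z‖ + ‖w‖

/-- The area integral `A_γ^{(q)} g(z) = (∫_{D(z,γ)} g(w)^q dτ(w))^{1/q}`, valued in `ℝ≥0∞`. -/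
def areaF {n : ℕ} (γ q : ℝ) (g : En n → ℝ) (z : En n) : ℝ≥0∞ :=
  (∫⁻ w in Dball z γ, ENNReal.ofReal (g w) ^ q ∂measTau n) ^ (1 / q)

/-- `|(1-|w|²) Rf(w)|`. -/
def radArea {n : ℕ} (f : En n → ℂ) (w : En n) : ℝ := (1 - ‖w‖ ^ 2) * ‖radD f w‖

/-- `|(1-|w|²) ∇f(w)|`, where `|∇f(w)|` is the Euclidean norm of the complex gradient. -/
def gradArea {n : ℕ} (f : En n → ℂ) (w : En n) : ℝ := (1 - ‖w‖ ^ 2) * ‖fderiv ℂ f w‖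

/-- `|∇̃f(w)| = |∇(f ∘ φ_w)(0)|`, the invariant gradient. -/
def invGradArea {n : ℕ} (f : En n → ℂ) (w : En n) : ℝ := ‖fderiv ℂ (f ∘ mobius w) 0‖


lemma herm_eq {n : ℕ} (z w : En n) : herm z w = inner ℂ w z := by
  simp [herm, PiLp.inner_apply]

lemma normsq_sub_smul {n : ℕ} (x w : En n) (a : ℂ) :
    ‖x - a • w‖ ^ 2 = ‖x‖ ^ 2 - 2 * (a * inner ℂ x w).re + ‖a‖ ^ 2 * ‖w‖ ^ 2 := by
  rw [@norm_sub_sq ℂ, inner_smul_right, norm_smul, mul_pow]; rfl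

/-- `w` is at bounded Bergman distance from `z`. -/
def rel {n : ℕ} (M : ℝ) (z w : En n) : Prop :=
  ‖z‖ < 1 ∧ ‖w‖ < 1 ∧ ‖1 - inner ℂ z w‖ ^ 2 ≤ M * ((1 - ‖z‖ ^ 2) * (1 - ‖w‖ ^ 2))

lemma one_sub_sq_pos {n : ℕ} {z : En n} (h : ‖z‖ < 1) : 0 < 1 - ‖z‖ ^ 2 := by
  nlinarith [norm_nonneg z]

lemma norm_one_sub_inner_comm {n : ℕ} (z w : En n) :
    ‖(1 : ℂ) - inner ℂ z w‖ = ‖(1 : ℂ) - inner ℂ w z‖ := by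
  rw [← inner_conj_symm w z, ← Complex.norm_conj (1 - inner ℂ z w)]
  simp

lemma rel_symm {n : ℕ} {M : ℝ} {z w : En n} (h : rel M z w) : rel M w z := by
  refine ⟨h.2.1, h.1, ?_⟩
  rw [norm_one_sub_inner_comm, mul_comm (1 - ‖w‖ ^ 2)]
  exact h.2.2

lemma le_norm_one_sub {n : ℕ} {z w : En n} (hz : ‖z‖ < 1) (hw : ‖w‖ < 1) :
    1 - ‖z‖ ^ 2 ≤ 2 * ‖(1 : ℂ) - inner ℂ z w‖ := by
  have h1 : ‖(inner ℂ z w : ℂ)‖ ≤ ‖z‖ := by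
    refine (norm_inner_le_norm (𝕜 := ℂ) z w).trans ?_
    nlinarith [norm_nonneg z, norm_nonneg w]
  have h2 : (1 : ℝ) - ‖(inner ℂ z w : ℂ)‖ ≤ ‖(1 : ℂ) - inner ℂ z w‖ := by
    simpa using norm_sub_norm_le (1 : ℂ) (inner ℂ z w)
  nlinarith [norm_nonneg z]

lemma rel_comp {n : ℕ} {M : ℝ} {z w : En n} (h : rel M z w) :
    1 - ‖z‖ ^ 2 ≤ 4 * M * (1 - ‖w‖ ^ 2) := by
  obtain ⟨hz, hw, h⟩ := h
  have h1 := le_norm_one_sub hz hw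
  have hz' := one_sub_sq_pos hz
  have : (1 - ‖z‖ ^ 2) * (1 - ‖z‖ ^ 2) ≤ (1 - ‖z‖ ^ 2) * (4 * M * (1 - ‖w‖ ^ 2)) := by
    nlinarith
  exact le_of_mul_le_mul_left this hz'

lemma rel_lin {n : ℕ} {M : ℝ} (hM : 0 ≤ M) {z w : En n} (h : rel M z w) :
    ‖(1 : ℂ) - inner ℂ z w‖ ≤ 2 * M * (1 - ‖z‖ ^ 2) := by
  have h1 := rel_comp (rel_symm h)
  obtain ⟨hz, hw, h⟩ := h
  have hz' := one_sub_sq_pos hz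
  apply le_of_sq_le_sq₀' _ (by positivity)
  calc _ ≤ _ := h
    _ ≤ M * ((1 - ‖z‖ ^ 2) * (4 * M * (1 - ‖z‖ ^ 2))) := by gcongr
    _ = _ := by ring
where
  le_of_sq_le_sq₀' {a b : ℝ} (h : a ^ 2 ≤ b ^ 2) (hb : 0 ≤ b) : a ≤ b := by
    nlinarith [sq_nonneg (a - b), sq_nonneg (a + b)]

lemma norm_sub_inner_sq {n : ℕ} {z w : En n} (hz : ‖z‖ < 1) (hw : ‖w‖ < 1) :
    ‖z - (inner ℂ w z : ℂ) • w‖ ^ 2 ≤ 2 * ‖(1 : ℂ) - inner ℂ w z‖ := by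
  rw [normsq_sub_smul]
  have h0 : ((inner ℂ w z : ℂ) * inner ℂ z w).re = ‖(inner ℂ w z : ℂ)‖ ^ 2 := by
    rw [← inner_conj_symm z w, Complex.mul_conj, Complex.normSq_eq_norm_sq]
    norm_cast
  rw [h0]
  have h1 : (1 : ℝ) - ‖(inner ℂ w z : ℂ)‖ ≤ ‖(1 : ℂ) - inner ℂ w z‖ := by
    simpa using norm_sub_norm_le (1 : ℂ) (inner ℂ w z)
  have h2 : ‖(inner ℂ w z : ℂ)‖ ≤ 1 := by
    refine (norm_inner_le_norm (𝕜 := ℂ) w z).trans ?_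
    nlinarith [norm_nonneg z, norm_nonneg w]
  have hw' := one_sub_sq_pos hw
  have hz' := one_sub_sq_pos hz
  nlinarith [norm_nonneg (inner ℂ w z : ℂ), mul_nonneg (sq_nonneg ‖(inner ℂ w z : ℂ)‖) hw'.le]

lemma quasi_tri {n : ℕ} {z w x : En n} (hz : ‖z‖ < 1) (hw : ‖w‖ < 1) (hx : ‖x‖ < 1) :
    ‖(1 : ℂ) - inner ℂ z x‖ ≤
      4 * ‖(1 : ℂ) - inner ℂ z w‖ + 2 * ‖(1 : ℂ) - inner ℂ w x‖ := by
  have h1 := norm_sub_inner_sq hz hw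
  have h2 := norm_sub_inner_sq hx hw
  rw [norm_one_sub_inner_comm w z] at h1
  have h3 := le_norm_one_sub hw hz
  rw [norm_one_sub_inner_comm w z] at h3
  have hw' := one_sub_sq_pos hw
  have ha : ‖(inner ℂ z w : ℂ)‖ ≤ 1 := by
    refine (norm_inner_le_norm (𝕜 := ℂ) z w).trans ?_
    nlinarith [norm_nonneg z, norm_nonneg w]
  have hb : ‖(inner ℂ w x : ℂ)‖ ≤ 1 := by
    refine (norm_inner_le_norm (𝕜 := ℂ) w x).trans ?_
    nlinarith [norm_nonneg w, norm_nonneg x]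
  have key : (1 : ℂ) - inner ℂ z x = (1 - inner ℂ z w) + inner ℂ z w * (1 - inner ℂ w x)
      - inner ℂ z w * inner ℂ w x * ((1 - ‖w‖ ^ 2 : ℝ) : ℂ)
      - inner ℂ (z - (inner ℂ w z : ℂ) • w) (x - (inner ℂ w x : ℂ) • w) := by
    simp only [inner_sub_left, inner_sub_right, inner_smul_left, inner_smul_right,
      inner_conj_symm, inner_self_eq_norm_sq_to_K]
    push_cast
    simp only [Complex.coe_algebraMap]
    ring
  rw [key]
  have e1 : ‖(inner ℂ z w : ℂ) * (1 - inner ℂ w x)‖ ≤ ‖(1 : ℂ) - inner ℂ w x‖ := by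
    rw [norm_mul]
    exact mul_le_of_le_one_left (norm_nonneg _) ha
  have e2 : ‖(inner ℂ z w : ℂ) * inner ℂ w x * ((1 - ‖w‖ ^ 2 : ℝ) : ℂ)‖ ≤ 1 - ‖w‖ ^ 2 := by
    rw [norm_mul, norm_mul, Complex.norm_of_nonneg hw'.le]
    refine mul_le_of_le_one_left hw'.le ?_
    exact mul_le_one₀ ha (norm_nonneg _) hb
  have e3 := norm_inner_le_norm (𝕜 := ℂ) (z - (inner ℂ w z : ℂ) • w) (x - (inner ℂ w x : ℂ) • w)
  have t1 := norm_sub_le ((1 - inner ℂ z w) + inner ℂ z w * (1 - inner ℂ w x)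
      - inner ℂ z w * inner ℂ w x * ((1 - ‖w‖ ^ 2 : ℝ) : ℂ))
      (inner ℂ (z - (inner ℂ w z : ℂ) • w) (x - (inner ℂ w x : ℂ) • w))
  have t2 := norm_sub_le ((1 - inner ℂ z w) + inner ℂ z w * (1 - inner ℂ w x))
      ((inner ℂ z w : ℂ) * inner ℂ w x * ((1 - ‖w‖ ^ 2 : ℝ) : ℂ))
  have t3 := norm_add_le ((1 : ℂ) - inner ℂ z w) (inner ℂ z w * (1 - inner ℂ w x))
  nlinarith [sq_nonneg (‖z - (inner ℂ w z : ℂ) • w‖ - ‖x - (inner ℂ w x : ℂ) • w‖)]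

lemma rel_trans {n : ℕ} {M M' : ℝ} (hM : 0 ≤ M) (hM' : 0 ≤ M') {z w x : En n}
    (h : rel M z w) (h' : rel M' w x) :
    rel ((8 * M + 4 * M') ^ 2 * (4 * M) * (4 * M')) z x := by
  have l1 := rel_lin hM (rel_symm h)
  rw [norm_one_sub_inner_comm] at l1
  have l2 := rel_lin hM' h'
  have t := quasi_tri h.1 h.2.1 h'.2.1
  have c1 := rel_comp (rel_symm h)
  have c2 := rel_comp h'
  have hz' := one_sub_sq_pos h.1
  have hw' := one_sub_sq_pos h.2.1
  have hx' := one_sub_sq_pos h'.2.1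
  refine ⟨h.1, h'.2.1, ?_⟩
  calc ‖(1 : ℂ) - inner ℂ z x‖ ^ 2 ≤ ((8 * M + 4 * M') * (1 - ‖w‖ ^ 2)) ^ 2 := by
        gcongr; linarith
    _ = (8 * M + 4 * M') ^ 2 * ((1 - ‖w‖ ^ 2) * (1 - ‖w‖ ^ 2)) := by ring
    _ ≤ (8 * M + 4 * M') ^ 2 * ((4 * M * (1 - ‖z‖ ^ 2)) * (4 * M' * (1 - ‖x‖ ^ 2))) := by
        gcongr
    _ = _ := by ring

lemma prj_eq {n : ℕ} (z w : En n) : prj z w = ((inner ℂ z w : ℂ) / inner ℂ z z) • z := by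
  unfold prj
  split_ifs with h
  · simp [h]
  · simp [herm_eq]

lemma mobius_identity {n : ℕ} {z w : En n} (hz : ‖z‖ < 1) (hw : ‖w‖ < 1) :
    ‖(1 : ℂ) - inner ℂ z w‖ ^ 2 * (1 - ‖mobius z w‖ ^ 2) = (1 - ‖z‖ ^ 2) * (1 - ‖w‖ ^ 2) := by
  have hN : 0 < ‖(1 : ℂ) - inner ℂ z w‖ := by
    have := le_norm_one_sub hz hw
    have := one_sub_sq_pos hz
    linarith
  have hs : Real.sqrt (1 - ‖z‖ ^ 2) ^ 2 = 1 - ‖z‖ ^ 2 := Real.sq_sqrt (one_sub_sq_pos hz).le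
  set s := Real.sqrt (1 - ‖z‖ ^ 2) with hsdef
  have e1 : ‖(1 : ℂ) - inner ℂ z w‖ ^ 2 * ‖mobius z w‖ ^ 2
      = ‖z - prj z w - (s : ℂ) • (w - prj z w)‖ ^ 2 := by
    unfold mobius
    rw [norm_smul, herm_eq, norm_div, norm_one, mul_pow, ← mul_assoc, ← mul_pow,
      mul_one_div_cancel hN.ne', one_pow, one_mul]
  rw [mul_sub, mul_one, e1, prj_eq]
  by_cases h0 : z = 0
  · subst h0
    simp [hsdef]
  have ht : 0 < ‖z‖ ^ 2 := by positivity
  set lam : ℂ := (inner ℂ z w : ℂ) / inner ℂ z z with hlam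
  have hin : (inner ℂ z z : ℂ) = ((‖z‖ ^ 2 : ℝ) : ℂ) := by
    rw [inner_self_eq_norm_sq_to_K]; simp
  have hzw : (inner ℂ z w : ℂ) = lam * ((‖z‖ ^ 2 : ℝ) : ℂ) := by
    rw [hlam, hin, div_mul_cancel₀]
    exact_mod_cast ht.ne'
  have e2 : ‖w - lam • z‖ ^ 2 = ‖w‖ ^ 2 - ‖lam‖ ^ 2 * ‖z‖ ^ 2 := by
    rw [normsq_sub_smul, ← inner_conj_symm w z, hzw]
    rw [map_mul, Complex.conj_ofReal, ← mul_assoc, Complex.mul_conj, Complex.normSq_eq_norm_sq]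
    rw [← Complex.ofReal_mul, Complex.ofReal_re]; ring
  have e4 : (inner ℂ z (w - lam • z) : ℂ) = 0 := by
    rw [inner_sub_right, inner_smul_right, hzw, hin]; ring
  have e3 : ‖z - lam • z - (s : ℂ) • (w - lam • z)‖ ^ 2
      = ‖1 - lam‖ ^ 2 * ‖z‖ ^ 2 + s ^ 2 * ‖w - lam • z‖ ^ 2 := by
    have : z - lam • z = (1 - lam) • z := by rw [sub_smul, one_smul]
    rw [this, @norm_sub_sq ℂ, inner_smul_right, inner_smul_left, e4, norm_smul, norm_smul]
    simp only [mul_zero, map_zero, mul_pow, Complex.norm_real, Real.norm_eq_abs, sq_abs]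
    ring
  rw [e3, e2, hs, hzw]
  generalize ‖z‖ ^ 2 = t
  simp only [← Complex.normSq_eq_norm_sq, Complex.normSq_apply]
  simp
  ring

lemma Dball_rel {n : ℕ} {z w : En n} {γ : ℝ} (hz : ‖z‖ < 1) (h : w ∈ Dball z γ) :
    rel (Real.exp (2 * γ)) z w := by
  obtain ⟨hw, hb⟩ := h
  have hw : ‖w‖ < 1 := by simpa [uball] using hw
  refine ⟨hz, hw, ?_⟩
  have hid := mobius_identity hz hw
  have hpos := mul_pos (one_sub_sq_pos hz) (one_sub_sq_pos hw)
  unfold bmet at hb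
  set x := ‖mobius z w‖ with hx
  have hx0 : 0 ≤ x := norm_nonneg _
  have hx1 : x < 1 := by
    by_contra hcon
    push Not at hcon
    have : 1 - x ^ 2 ≤ 0 := by nlinarith
    nlinarith [sq_nonneg ‖(1 : ℂ) - inner ℂ z w‖]
  have h1 : (1 + x) / (1 - x) < Real.exp (2 * γ) := by
    rw [← Real.log_lt_iff_lt_exp]
    · linarith
    · apply div_pos <;> linarith
  rw [div_lt_iff₀ (by linarith)] at h1
  rw [← hid]
  have h2 : 1 ≤ Real.exp (2 * γ) * (1 - x ^ 2) := by
    nlinarith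
  nlinarith [sq_nonneg ‖(1 : ℂ) - inner ℂ z w‖]

def sq1 {n : ℕ} (z : En n) : ℝ := Real.sqrt (1 - ‖z‖ ^ 2)

lemma sq1_pos {n : ℕ} {z : En n} (hz : ‖z‖ < 1) : 0 < sq1 z :=
  Real.sqrt_pos.2 (one_sub_sq_pos hz)

lemma sq1_sq {n : ℕ} {z : En n} (hz : ‖z‖ < 1) : sq1 z ^ 2 = 1 - ‖z‖ ^ 2 :=
  Real.sq_sqrt (one_sub_sq_pos hz).le

lemma sq1_le {n : ℕ} {z : En n} : sq1 z ≤ 1 := by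
  unfold sq1
  rw [Real.sqrt_le_left (by norm_num)]
  nlinarith [norm_nonneg z]

/-- the linear map `u ↦ s u - (s/(1+s)) ⟨u,z⟩ z`. -/
def Lm {n : ℕ} (z : En n) : En n →L[ℂ] En n :=
  (sq1 z : ℂ) • (ContinuousLinearMap.id ℂ (En n) -
    ((1 / (1 + sq1 z) : ℝ) : ℂ) • (innerSL ℂ z).smulRight z)

lemma Lm_apply {n : ℕ} (z u : En n) :
    Lm z u = (sq1 z : ℂ) • (u - (((1 / (1 + sq1 z) : ℝ) : ℂ) * inner ℂ z u) • z) := by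
  simp [Lm, smul_smul]

lemma Lm_det {n : ℕ} {z : En n} (hz : ‖z‖ < 1) :
    LinearMap.det ((Lm z : En n →ₗ[ℂ] En n).restrictScalars ℝ) = (1 - ‖z‖ ^ 2) ^ (n + 1) := by
  have h1 : (Lm z : En n →ₗ[ℂ] En n) = (sq1 z : ℂ) •
      LinearMap.transvection (-((1 / (1 + sq1 z) : ℝ) : ℂ) • (innerSL ℂ z : En n →ₗ[ℂ] ℂ)) z := by
    ext1 u
    simp [Lm_apply, LinearMap.transvection.apply, sub_eq_add_neg]
  have hs := sq1_pos hz
  have hs2 := sq1_sq hz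
  have h2 : LinearMap.det (Lm z : En n →ₗ[ℂ] En n) = ((sq1 z ^ (n + 1) : ℝ) : ℂ) := by
    rw [h1, LinearMap.det_smul, LinearMap.transvection.det]
    have hin : (inner ℂ z z : ℂ) = ((‖z‖ ^ 2 : ℝ) : ℂ) := by
      rw [inner_self_eq_norm_sq_to_K]; simp
    have e : (-((1 / (1 + sq1 z) : ℝ) : ℂ) • (innerSL ℂ z : En n →ₗ[ℂ] ℂ)) z
      = ((sq1 z - 1 : ℝ) : ℂ) := by
      simp only [LinearMap.smul_apply, ContinuousLinearMap.coe_coe, innerSL_apply_apply, hin,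
        smul_eq_mul]
      rw [← Complex.ofReal_neg, ← Complex.ofReal_mul]
      congr 1
      have : ‖z‖ ^ 2 = 1 - sq1 z ^ 2 := by linarith
      rw [this]
      field_simp
      ring
    rw [e]
    simp [pow_succ]
  rw [LinearMap.det_restrictScalars, h2, Algebra.norm_complex_apply, Complex.normSq_ofReal,
    ← hs2]
  ring

lemma inner_Lm {n : ℕ} {z : En n} (hz : ‖z‖ < 1) (u : En n) :
    (inner ℂ z (Lm z u) : ℂ) = ((1 - ‖z‖ ^ 2 : ℝ) : ℂ) * inner ℂ z u := by
  have hin : (inner ℂ z z : ℂ) = ((‖z‖ ^ 2 : ℝ) : ℂ) := by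
    rw [inner_self_eq_norm_sq_to_K]; simp
  have hs := sq1_pos hz
  have hs2 := sq1_sq hz
  have : ‖z‖ ^ 2 = 1 - sq1 z ^ 2 := by linarith
  rw [Lm_apply, inner_smul_right, inner_sub_right, inner_smul_right, hin, this]
  have h : (1 + sq1 z : ℂ) ≠ 0 := by exact_mod_cast (by positivity : (1 + sq1 z : ℝ) ≠ 0)
  push_cast
  field_simp
  ring

lemma norm_Lm {n : ℕ} {z : En n} (hz : ‖z‖ < 1) (u : En n) :
    ‖Lm z u‖ ^ 2 ≤ (1 - ‖z‖ ^ 2) * ‖u‖ ^ 2 := by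
  have hs := sq1_pos hz
  have hs2 := sq1_sq hz
  have hs3 := sq1_le (z := z)
  rw [Lm_apply, norm_smul, mul_pow, normsq_sub_smul]
  have h0 : ((((1 / (1 + sq1 z) : ℝ) : ℂ) * inner ℂ z u) * inner ℂ u z).re
      = (1 / (1 + sq1 z)) * ‖(inner ℂ z u : ℂ)‖ ^ 2 := by
    rw [mul_assoc, ← inner_conj_symm u z, Complex.mul_conj, Complex.normSq_eq_norm_sq,
      ← Complex.ofReal_mul, Complex.ofReal_re]
  rw [h0, norm_mul]
  simp only [Complex.norm_real, Real.norm_eq_abs, sq_abs, mul_pow]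
  rw [hs2]
  have hz' := one_sub_sq_pos hz
  have ha : 1 / (1 + sq1 z) ≤ 1 := by
    rw [div_le_one (by positivity)]; linarith
  have ha0 : 0 < 1 / (1 + sq1 z) := by positivity
  generalize 1 / (1 + sq1 z) = a at *
  apply mul_le_mul_of_nonneg_left _ hz'.le
  have : a ^ 2 * ‖z‖ ^ 2 ≤ a := by nlinarith [norm_nonneg z]
  nlinarith [mul_nonneg (sub_nonneg.2 this) (sq_nonneg ‖(inner ℂ z u : ℂ)‖), 
    mul_nonneg ha0.le (sq_nonneg ‖(inner ℂ z u : ℂ)‖)]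

lemma Lm_inv {n : ℕ} {z : En n} (hz : ‖z‖ < 1) (h : En n) :
    ∃ u, Lm z u = h ∧ ‖u‖ ≤ ‖h‖ / sq1 z + ‖(inner ℂ z h : ℂ)‖ / (1 - ‖z‖ ^ 2) := by
  have hs := sq1_pos hz
  have hs2 := sq1_sq hz
  have hin : (inner ℂ z z : ℂ) = ((‖z‖ ^ 2 : ℝ) : ℂ) := by
    rw [inner_self_eq_norm_sq_to_K]; simp
  have ht : ‖z‖ ^ 2 = 1 - sq1 z ^ 2 := by linarith
  refine ⟨((1 / sq1 z : ℝ) : ℂ) • h +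
    (((1 / (sq1 z ^ 2 * (1 + sq1 z)) : ℝ) : ℂ) * inner ℂ z h) • z, ?_, ?_⟩
  · rw [Lm_apply, inner_add_right, inner_smul_right, inner_smul_right, hin, ht]
    have h1 : (1 + sq1 z : ℂ) ≠ 0 := by exact_mod_cast (by positivity : (1 + sq1 z : ℝ) ≠ 0)
    have h2 : (sq1 z : ℂ) ≠ 0 := by exact_mod_cast hs.ne'
    push_cast
    match_scalars
    · field_simp
    · field_simp
      ring
  · refine (norm_add_le _ _).trans (add_le_add ?_ ?_)
    · rw [norm_smul, Complex.norm_of_nonneg (by positivity)]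
      apply le_of_eq; ring
    · rw [norm_smul, norm_mul, Complex.norm_of_nonneg (by positivity), ← hs2]
      have : 1 / (sq1 z ^ 2 * (1 + sq1 z)) ≤ 1 / sq1 z ^ 2 := by
        apply one_div_le_one_div_of_le (by positivity)
        nlinarith [sq_nonneg (sq1 z)]
      calc _ ≤ 1 / sq1 z ^ 2 * ‖(inner ℂ z h : ℂ)‖ * 1 := by
            gcongr
        _ = _ := by ring

lemma Lm_rel {n : ℕ} {z u : En n} (hz : ‖z‖ < 1) (hu : ‖u‖ ≤ 1 / 4) :
    rel 16 z (z + Lm z u) := by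
  have hz' := one_sub_sq_pos hz
  have h1 := norm_Lm hz u
  have h2 := inner_Lm hz u
  have h3 : ‖(inner ℂ z u : ℂ)‖ ≤ 1 / 4 := by
    refine (norm_inner_le_norm (𝕜 := ℂ) z u).trans ?_
    nlinarith [norm_nonneg z, norm_nonneg u]
  have hin : (inner ℂ z z : ℂ) = ((‖z‖ ^ 2 : ℝ) : ℂ) := by
    rw [inner_self_eq_norm_sq_to_K]; simp
  have h4 : ‖z + Lm z u‖ ^ 2 = ‖z‖ ^ 2 + 2 * ((1 - ‖z‖ ^ 2) * (inner ℂ z u : ℂ).re) +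
      ‖Lm z u‖ ^ 2 := by
    rw [@norm_add_sq ℂ, h2]
    simp only [RCLike.re_eq_complex_re, Complex.re_ofReal_mul]
  have h5 : (inner ℂ z u : ℂ).re ≤ 1 / 4 := (Complex.re_le_norm _).trans h3
  have h6 : (1 - ‖z‖ ^ 2) / 4 ≤ 1 - ‖z + Lm z u‖ ^ 2 := by
    rw [h4]
    have h9 : ‖u‖ ^ 2 ≤ 1 / 16 := by nlinarith [norm_nonneg u]
    nlinarith [mul_le_mul_of_nonneg_left h9 hz'.le, mul_le_mul_of_nonneg_left h5 hz'.le]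
  refine ⟨hz, by nlinarith [norm_nonneg (z + Lm z u)], ?_⟩
  have h7 : (1 : ℂ) - inner ℂ z (z + Lm z u) = ((1 - ‖z‖ ^ 2 : ℝ) : ℂ) * (1 - inner ℂ z u) := by
    rw [inner_add_right, hin, h2]; push_cast; ring
  have h8 : ‖(1 : ℂ) - inner ℂ z u‖ ≤ 2 := by
    refine (norm_sub_le _ _).trans ?_
    rw [norm_one]; linarith
  rw [h7, norm_mul, Complex.norm_of_nonneg hz'.le, mul_pow]
  have : ‖(1 : ℂ) - inner ℂ z u‖ ^ 2 ≤ 4 := by nlinarith [norm_nonneg ((1 : ℂ) - inner ℂ z u)]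
  nlinarith [mul_le_mul_of_nonneg_left h6 hz'.le, mul_le_mul_of_nonneg_left this (sq_nonneg (1 - ‖z‖^2))]

instance (n : ℕ) : (vol n).IsAddHaarMeasure := by unfold vol; infer_instance

lemma rel_vol {n : ℕ} {M : ℝ} (hM : 0 ≤ M) {z : En n} (hz : ‖z‖ < 1) :
    vol n {w | rel M z w} ≤ ENNReal.ofReal ((1 - ‖z‖ ^ 2) ^ (n + 1)) *
      vol n (Metric.closedBall 0 (Real.sqrt (4 * M + 3) + (2 * M + 1))) := by
  have hs := sq1_pos hz
  have hs2 := sq1_sq hz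
  have hz' := one_sub_sq_pos hz
  have hin : (inner ℂ z z : ℂ) = ((‖z‖ ^ 2 : ℝ) : ℂ) := by
    rw [inner_self_eq_norm_sq_to_K]; simp
  have key := Measure.addHaar_image_linearMap (vol n) ((Lm z : En n →ₗ[ℂ] En n).restrictScalars ℝ)
    (Metric.closedBall 0 (Real.sqrt (4 * M + 3) + (2 * M + 1)))
  rw [Lm_det hz, abs_of_nonneg (by positivity)] at key
  rw [← key, ← measure_preimage_add (vol n) z]
  apply measure_mono
  intro h hh
  simp only [Set.mem_preimage, Set.mem_setOf_eq] at hh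
  obtain ⟨u, hu, hu2⟩ := Lm_inv hz h
  refine ⟨u, ?_, hu⟩
  rw [mem_closedBall_zero_iff]
  refine hu2.trans ?_
  have l := rel_lin hM hh
  have hw := hh.2.1
  have a1 : (inner ℂ z h : ℂ) = ((1 - ‖z‖ ^ 2 : ℝ) : ℂ) - (1 - inner ℂ z (z + h)) := by
    rw [inner_add_right, hin]; push_cast; ring
  have a2 : ‖(inner ℂ z h : ℂ)‖ ≤ (2 * M + 1) * (1 - ‖z‖ ^ 2) := by
    rw [a1]
    refine (norm_sub_le _ _).trans ?_
    rw [Complex.norm_of_nonneg hz'.le]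
    linarith
  have a3 : ‖h‖ ^ 2 ≤ (4 * M + 3) * (1 - ‖z‖ ^ 2) := by
    have b1 : ‖z + h‖ ^ 2 = ‖z‖ ^ 2 + 2 * (inner ℂ z h : ℂ).re + ‖h‖ ^ 2 := by
      rw [@norm_add_sq ℂ]; rfl
    have b2 : -(inner ℂ z h : ℂ).re ≤ ‖(inner ℂ z h : ℂ)‖ := by
      have := Complex.re_le_norm (-(inner ℂ z h : ℂ))
      simpa using this
    nlinarith [norm_nonneg (z + h)]
  apply add_le_add
  · apply Real.le_sqrt_of_sq_le
    rw [div_pow, hs2, div_le_iff₀ hz']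
    exact a3
  · rw [div_le_iff₀ hz']; exact a2

lemma mobius_zero {n : ℕ} (z : En n) : mobius z 0 = z := by
  simp [mobius, herm_eq, prj_eq]

lemma mobius_hasFDerivAt {n : ℕ} {z : En n} (hz : ‖z‖ < 1) :
    HasFDerivAt (mobius z) (-(Lm z)) 0 := by
  have hs := sq1_pos hz
  have hs2 := sq1_sq hz
  have ht : ‖z‖ ^ 2 = 1 - sq1 z ^ 2 := by linarith
  have hin : (inner ℂ z z : ℂ) = ((‖z‖ ^ 2 : ℝ) : ℂ) := by
    rw [inner_self_eq_norm_sq_to_K]; simp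
  have hm : mobius z = fun w => ((1 : ℂ) - innerSL ℂ z w)⁻¹ • (z - (((1 : ℂ) - sq1 z) •
      (((inner ℂ z z : ℂ)⁻¹ • (innerSL ℂ z).smulRight z)) + (sq1 z : ℂ) • ContinuousLinearMap.id ℂ (En n)) w) := by
    funext w
    unfold mobius
    rw [prj_eq, herm_eq, one_div]
    change (1 - inner ℂ z w : ℂ)⁻¹ • (_ - (sq1 z : ℂ) • _) = _
    simp only [innerSL_apply_apply, ContinuousLinearMap.add_apply, ContinuousLinearMap.smul_apply,
      ContinuousLinearMap.smulRight_apply, ContinuousLinearMap.id_apply]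
    congr 1
    module
  rw [hm]
  have d1 : HasFDerivAt (fun w : En n => (1 : ℂ) - innerSL ℂ z w) (-(innerSL ℂ z)) 0 := by
    simpa using (innerSL ℂ z).hasFDerivAt.const_sub (1 : ℂ) (x := 0)
  have d2 : HasFDerivAt (fun w : En n => ((1 : ℂ) - innerSL ℂ z w)⁻¹) (innerSL ℂ z) 0 := by
    have := (hasDerivAt_inv (x := (1 : ℂ) - innerSL ℂ z 0) (by simp)).comp_hasFDerivAt (0 : En n) d1
    refine this.congr_fderiv ?_
    simp
  have d3 := ((((1 : ℂ) - sq1 z) •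
      (((inner ℂ z z : ℂ)⁻¹ • (innerSL ℂ z).smulRight z)) + (sq1 z : ℂ) • ContinuousLinearMap.id ℂ (En n)).hasFDerivAt
      (x := 0)).const_sub z
  refine (d2.smul d3).congr_fderiv ?_
  ext1 u
  by_cases h0 : z = 0
  · subst h0
    simp [Lm_apply]
  have ht0 : ((1 : ℂ) - sq1 z ^ 2) ≠ 0 := by
    have : (1 - sq1 z ^ 2 : ℝ) ≠ 0 := by rw [← ht]; positivity
    exact_mod_cast this
  have h1 : (1 + sq1 z : ℂ) ≠ 0 := by exact_mod_cast (by positivity : (1 + sq1 z : ℝ) ≠ 0)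
  simp only [hin, ht, Lm_apply, innerSL_apply_apply, ContinuousLinearMap.add_apply,
    ContinuousLinearMap.smul_apply, map_zero, ContinuousLinearMap.neg_apply,
      ContinuousLinearMap.smulRight_apply, ContinuousLinearMap.id_apply]
  push_cast
  match_scalars
  · simp
    field_simp
    ring
  · simp

lemma mp_smul {n : ℕ} (c : ℂ) (hc : ‖c‖ = 1) :
    MeasurePreserving (fun h : En n => c • h) (vol n) (vol n) := by
  have hd : LinearMap.det (((c • LinearMap.id : En n →ₗ[ℂ] En n)).restrictScalars ℝ) = 1 := by
    rw [LinearMap.det_restrictScalars, LinearMap.det_smul, LinearMap.det_id,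
      Algebra.norm_complex_apply, Complex.normSq_eq_norm_sq]
    simp [hc]
  have := Measure.map_linearMap_addHaar_eq_smul_addHaar (vol n)
    (f := ((c • LinearMap.id : En n →ₗ[ℂ] En n)).restrictScalars ℝ) (by rw [hd]; norm_num)
  rw [hd] at this
  refine ⟨by fun_prop, ?_⟩
  have h2 : Measure.map (c • (id : En n → En n)) (vol n) = vol n := by simpa using this
  exact h2

lemma meas_ind {n : ℕ} {s : Set (En n)} (hs : IsOpen s) {F : En n → ℝ≥0∞}
      (hc : ContinuousOn F s) : Measurable (s.indicator F) := by
  rw [← Set.piecewise_eq_indicator]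
  exact ContinuousOn.measurable_piecewise hc continuousOn_const hs.measurableSet

lemma circ_mean {n : ℕ} {g : En n → ℂ} {ρ r : ℝ} (hg : DifferentiableOn ℂ g (Metric.ball 0 ρ))
    {u h : En n} (hu : ‖u‖ + r ≤ ρ) (hh : ‖h‖ < r) :
    ‖g u‖ₑ ≤ ENNReal.ofReal (2 * Real.pi)⁻¹ *
      ∫⁻ θ in Set.Ioc 0 (2 * Real.pi), ‖g (u + circleMap 0 1 θ • h)‖ₑ := by
  have hd : ∀ c ∈ Metric.closedBall (0 : ℂ) |1|, DifferentiableAt ℂ (fun c : ℂ => g (u + c • h)) c := by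
    intro c hc
    have hc' : ‖c‖ ≤ 1 := by simpa using hc
    have hmem : u + c • h ∈ Metric.ball (0 : En n) ρ := by
      rw [mem_ball_zero_iff]
      have h1 := norm_add_le u (c • h)
      rw [norm_smul] at h1
      nlinarith [norm_nonneg h, norm_nonneg c]
    have h1 : DifferentiableAt ℂ g (u + c • h) :=
      hg.differentiableAt (Metric.isOpen_ball.mem_nhds hmem)
    exact h1.comp c (f := fun c : ℂ => u + c • h) (by fun_prop)
  have h1 := circleAverage_of_differentiable_on_off_countable (f := fun c : ℂ => g (u + c • h))
    (c := 0) (R := 1) Set.countable_empty (fun c hc => (hd c hc).continuousAt.continuousWithinAt)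
    (fun c hc => hd c (Metric.ball_subset_closedBall hc.1))
  rw [Real.circleAverage_def] at h1
  simp only [zero_smul, add_zero] at h1
  have h2 : ‖g u‖ₑ = ENNReal.ofReal (2 * Real.pi)⁻¹ *
      ‖∫ θ in (0:ℝ)..2 * Real.pi, g (u + circleMap 0 1 θ • h)‖ₑ := by
    rw [← h1, enorm_smul, Real.enorm_eq_ofReal (by positivity)]
  rw [h2, intervalIntegral.integral_of_le (by positivity)]
  gcongr
  exact enorm_integral_le_lintegral_enorm _

lemma ball_mean {n : ℕ} {g : En n → ℂ} {ρ r : ℝ} (hg : DifferentiableOn ℂ g (Metric.ball 0 ρ))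
    {u : En n} (hu : ‖u‖ + r ≤ ρ) :
    ‖g u‖ₑ * vol n (Metric.ball 0 r) ≤ ∫⁻ h in Metric.ball 0 r, ‖g (u + h)‖ₑ ∂vol n := by
  set φ : En n → ℝ≥0∞ := (Metric.ball 0 r).indicator (fun h => ‖g (u + h)‖ₑ) with hφ
  have hφm : Measurable φ := by
    have hc : ContinuousOn (fun h => ‖g (u + h)‖ₑ) (Metric.ball (0 : En n) r) := by
      apply ContinuousOn.enorm
      refine hg.continuousOn.comp (f := fun h => u + h) (by fun_prop) ?_
      intro h hh
      rw [mem_ball_zero_iff] at hh ⊢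
      have := norm_add_le u h
      linarith
    rw [hφ]
    exact meas_ind Metric.isOpen_ball hc
  rw [← lintegral_indicator Metric.isOpen_ball.measurableSet]
  change _ ≤ ∫⁻ h, φ h ∂vol n
  calc ‖g u‖ₑ * vol n (Metric.ball 0 r) = ∫⁻ h in Metric.ball 0 r, ‖g u‖ₑ ∂vol n := by
        rw [setLIntegral_const]
    _ ≤ ∫⁻ h in Metric.ball 0 r, (ENNReal.ofReal (2 * Real.pi)⁻¹ *
          ∫⁻ θ in Set.Ioc 0 (2 * Real.pi), φ (circleMap 0 1 θ • h)) ∂vol n := by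
        apply setLIntegral_mono' Metric.isOpen_ball.measurableSet
        intro h hh
        rw [mem_ball_zero_iff] at hh
        refine (circ_mean hg hu hh).trans_eq ?_
        congr 2
        funext θ
        rw [hφ, Set.indicator_of_mem]
        rw [mem_ball_zero_iff, norm_smul]
        simpa using hh
    _ ≤ ∫⁻ h, (ENNReal.ofReal (2 * Real.pi)⁻¹ *
          ∫⁻ θ in Set.Ioc 0 (2 * Real.pi), φ (circleMap 0 1 θ • h)) ∂vol n :=
        setLIntegral_le_lintegral _ _
    _ = ENNReal.ofReal (2 * Real.pi)⁻¹ * ∫⁻ h,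
          (∫⁻ θ in Set.Ioc 0 (2 * Real.pi), φ (circleMap 0 1 θ • h)) ∂vol n :=
        lintegral_const_mul' _ _ ENNReal.ofReal_ne_top
    _ = ENNReal.ofReal (2 * Real.pi)⁻¹ * ∫⁻ θ in Set.Ioc (0 : ℝ) (2 * Real.pi), ∫⁻ h,
          φ (circleMap 0 1 θ • h) ∂vol n := by
        rw [lintegral_lintegral_swap]
        apply Measurable.aemeasurable
        refine hφm.comp ?_
        apply Continuous.measurable
        have := continuous_circleMap 0 1
        fun_prop
    _ = ENNReal.ofReal (2 * Real.pi)⁻¹ * ∫⁻ θ in Set.Ioc (0 : ℝ) (2 * Real.pi), ∫⁻ h,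
          φ h ∂vol n := by
        congr 2
        funext θ
        exact (mp_smul (circleMap 0 1 θ) (by simp)).lintegral_comp hφm
    _ = ∫⁻ h, φ h ∂vol n := by
        rw [setLIntegral_const, Real.volume_Ioc, sub_zero, mul_comm (∫⁻ h, φ h ∂vol n), ← mul_assoc,
          ← ENNReal.ofReal_mul (by positivity), inv_mul_cancel₀ (by positivity)]
        simp

lemma ball_mean_p {n : ℕ} {g : En n → ℂ} {ρ r p : ℝ} (hp : 1 < p)
    (hg : DifferentiableOn ℂ g (Metric.ball 0 ρ))
    {u : En n} (hr : 0 < r) (hu : ‖u‖ + r ≤ ρ) :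
    ‖g u‖ₑ ^ p ≤ ((vol n (Metric.ball 0 r))⁻¹ ^ p * (vol n (Metric.ball 0 r)) ^ (p - 1)) *
      ∫⁻ h in Metric.ball 0 ρ, ‖g h‖ₑ ^ p ∂vol n := by
  set V := vol n (Metric.ball 0 r) with hV
  have hV0 : V ≠ 0 := (Metric.measure_ball_pos (vol n) 0 hr).ne'
  have hVt : V ≠ ⊤ := measure_ball_lt_top.ne
  have hsub : ∀ h ∈ Metric.ball (0 : En n) r, u + h ∈ Metric.ball (0 : En n) ρ := by
    intro h hh
    rw [mem_ball_zero_iff] at hh ⊢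
    have := norm_add_le u h
    linarith
  have hp0 : 0 < p := by linarith
  have h1 := ball_mean hg hu
  have hae : AEMeasurable (fun h => ‖g (u + h)‖ₑ) ((vol n).restrict (Metric.ball 0 r)) := by
    apply ContinuousOn.aemeasurable _ Metric.isOpen_ball.measurableSet
    apply ContinuousOn.enorm
    exact hg.continuousOn.comp (f := fun h => u + h) (by fun_prop) hsub
  have h2 := ENNReal.lintegral_mul_le_Lp_mul_Lq ((vol n).restrict (Metric.ball 0 r))
    (Real.HolderConjugate.conjExponent hp) hae (g := fun _ => 1) aemeasurable_const
  have hq : 1 / p.conjExponent * p = p - 1 := by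
    rw [Real.conjExponent]; field_simp
  simp only [Pi.mul_apply, mul_one, ENNReal.one_rpow, lintegral_const, one_mul,
    Measure.restrict_apply_univ] at h2
  have h3 : (‖g u‖ₑ * V) ^ p ≤ (∫⁻ h in Metric.ball 0 r, ‖g (u + h)‖ₑ ^ p ∂vol n) * V ^ (p - 1) := by
    refine (ENNReal.rpow_le_rpow (h1.trans h2) hp0.le).trans_eq ?_
    rw [ENNReal.mul_rpow_of_nonneg _ _ hp0.le, ← ENNReal.rpow_mul, ← ENNReal.rpow_mul, hq,
      one_div_mul_cancel hp0.ne', ENNReal.rpow_one]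
  have h4 : ∫⁻ h in Metric.ball 0 r, ‖g (u + h)‖ₑ ^ p ∂vol n ≤
      ∫⁻ h in Metric.ball 0 ρ, ‖g h‖ₑ ^ p ∂vol n := by
    rw [← lintegral_indicator Metric.isOpen_ball.measurableSet,
      ← lintegral_indicator Metric.isOpen_ball.measurableSet,
      ← lintegral_add_left_eq_self (μ := vol n) ((Metric.ball 0 ρ).indicator _) u]
    apply lintegral_mono
    intro h
    by_cases hh : h ∈ Metric.ball (0 : En n) r
    · simp only [Set.indicator_of_mem hh, Set.indicator_of_mem (hsub h hh)]; exact le_rfl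
    · simp [Set.indicator_of_notMem hh]
  calc ‖g u‖ₑ ^ p = (‖g u‖ₑ * V) ^ p * V⁻¹ ^ p := by
        rw [← ENNReal.mul_rpow_of_nonneg _ _ hp0.le, mul_assoc, ENNReal.mul_inv_cancel hV0 hVt,
          mul_one]
    _ ≤ ((∫⁻ h in Metric.ball 0 ρ, ‖g h‖ₑ ^ p ∂vol n) * V ^ (p - 1)) * V⁻¹ ^ p := by
        gcongr
        exact h3.trans (by gcongr)
    _ = _ := by ring

lemma fderiv_mean_p (n : ℕ) {p : ℝ} (hp : 1 < p) : ∃ K : ℝ≥0∞, K ≠ ⊤ ∧ ∀ g : En n → ℂ,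
    DifferentiableOn ℂ g (Metric.ball 0 (1 / 4)) →
    ‖fderiv ℂ g 0‖ₑ ^ p ≤ K * ∫⁻ h in Metric.ball 0 (1 / 4), ‖g h‖ₑ ^ p ∂vol n := by
  set V := vol n (Metric.ball 0 (1 / 8)) with hV
  have hV0 : V ≠ 0 := (Metric.measure_ball_pos (vol n) 0 (by norm_num)).ne'
  have hVt : V ≠ ⊤ := measure_ball_lt_top.ne
  have hp0 : 0 < p := by linarith
  set K₀ := V⁻¹ ^ p * V ^ (p - 1) with hK₀
  have hK0 : K₀ ≠ 0 := by
    rw [hK₀]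
    clear_value V
    refine mul_ne_zero ?_ ?_ <;> simp [ENNReal.rpow_eq_zero_iff, hV0, hVt]
  have hKt : K₀ ≠ ⊤ := by
    rw [hK₀]
    refine ENNReal.mul_ne_top ?_ ?_
    · exact ENNReal.rpow_ne_top_of_nonneg hp0.le (by simp [hV0])
    · exact ENNReal.rpow_ne_top_of_nonneg (by linarith) hVt
  have h16 : (16 : ℝ≥0∞) ^ p ≠ ⊤ := ENNReal.rpow_ne_top_of_nonneg hp0.le (by norm_num)
  refine ⟨16 ^ p * K₀, ENNReal.mul_ne_top h16 hKt, ?_⟩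
  intro g hg
  set S := ∫⁻ h in Metric.ball 0 (1 / 4), ‖g h‖ₑ ^ p ∂vol n with hS
  by_cases hSt : S = ⊤
  · rw [hSt, ENNReal.mul_top]
    · exact le_top
    · refine mul_ne_zero ?_ hK0
      simp [ENNReal.rpow_eq_zero_iff]
  have hsup : ∀ u : En n, ‖u‖ ≤ 1 / 16 → ‖g u‖ ≤ ((K₀ * S) ^ (1 / p)).toReal := by
    intro u hu
    have h1 := ball_mean_p hp hg (r := 1 / 8) (u := u) (by norm_num) (by linarith)
    have h2 : ‖g u‖ₑ ≤ (K₀ * S) ^ (1 / p) := by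
      rw [one_div, ENNReal.le_rpow_inv_iff hp0]
      exact h1
    rw [← toReal_enorm]
    refine ENNReal.toReal_mono ?_ h2
    exact ENNReal.rpow_ne_top_of_nonneg (by positivity) (ENNReal.mul_ne_top hKt hSt)
  set B := ((K₀ * S) ^ (1 / p)).toReal with hB
  have hB0 : 0 ≤ B := ENNReal.toReal_nonneg
  have hf : ‖fderiv ℂ g 0‖ ≤ 16 * B := by
    refine ContinuousLinearMap.opNorm_le_bound _ (by positivity) ?_
    intro v
    by_cases hv : v = 0
    · simp [hv]
    have hv0 : 0 < ‖v‖ := norm_pos_iff.2 hv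
    have hd : ∀ c ∈ Metric.closedBall (0 : ℂ) (1 / (16 * ‖v‖)),
        DifferentiableAt ℂ (fun c : ℂ => g (c • v)) c ∧ ‖c • v‖ ≤ 1 / 16 := by
      intro c hc
      have hc' : ‖c‖ ≤ 1 / (16 * ‖v‖) := by simpa using hc
      have h3 : ‖c • v‖ ≤ 1 / 16 := by
        rw [norm_smul]
        calc ‖c‖ * ‖v‖ ≤ 1 / (16 * ‖v‖) * ‖v‖ := by gcongr
          _ = 1 / 16 := by field_simp
      have hmem : c • v ∈ Metric.ball (0 : En n) (1 / 4) := by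
        rw [mem_ball_zero_iff]; linarith
      refine ⟨?_, h3⟩
      have h1 : DifferentiableAt ℂ g (c • v) :=
        hg.differentiableAt (Metric.isOpen_ball.mem_nhds hmem)
      exact h1.comp c (f := fun c : ℂ => c • v) (by fun_prop)
    have h4 := Complex.norm_deriv_le_of_forall_mem_sphere_norm_le (c := 0)
      (R := 1 / (16 * ‖v‖)) (C := B) (f := fun c : ℂ => g (c • v)) (by positivity)
      (DifferentiableOn.diffContOnCl (by
        rw [closure_ball _ (by positivity)]
        exact fun c hc => (hd c hc).1.differentiableWithinAt))
      (fun c hc => hsup _ (hd c (Metric.sphere_subset_closedBall hc)).2)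
    have h5 : HasDerivAt (fun c : ℂ => g (c • v)) (fderiv ℂ g 0 v) 0 := by
      have h6 : HasFDerivAt g (fderiv ℂ g 0) ((0 : ℂ) • v) := by
        rw [zero_smul]
        exact (hg.differentiableAt (Metric.isOpen_ball.mem_nhds (by simp))).hasFDerivAt
      have h7 : HasDerivAt (fun c : ℂ => c • v) v 0 := by
        simpa using (hasDerivAt_id (0 : ℂ)).smul_const v
      exact h6.comp_hasDerivAt (0 : ℂ) h7
    rw [h5.deriv] at h4
    refine h4.trans_eq ?_
    field_simp
  have hfe : ‖fderiv ℂ g 0‖ₑ ≤ 16 * (K₀ * S) ^ (1 / p) := by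
    rw [← ofReal_norm]
    refine (ENNReal.ofReal_le_ofReal hf).trans_eq ?_
    rw [ENNReal.ofReal_mul (by norm_num), hB, ENNReal.ofReal_toReal]
    · norm_num
    · exact ENNReal.rpow_ne_top_of_nonneg (by positivity) (ENNReal.mul_ne_top hKt hSt)
  refine (ENNReal.rpow_le_rpow hfe hp0.le).trans_eq ?_
  rw [ENNReal.mul_rpow_of_nonneg _ _ hp0.le, ← ENNReal.rpow_mul, one_div_mul_cancel hp0.ne',
    ENNReal.rpow_one, ← mul_assoc]

lemma mem_uball {n : ℕ} {z : En n} : z ∈ uball n ↔ ‖z‖ < 1 := by simp [uball]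

lemma rel_meas (n : ℕ) (M : ℝ) : MeasurableSet {x : En n × En n | rel M x.1 x.2} := by
  have h1 : MeasurableSet {x : En n × En n | ‖x.1‖ < 1} := measurableSet_lt (by fun_prop) (by fun_prop)
  have h2 : MeasurableSet {x : En n × En n | ‖x.2‖ < 1} := measurableSet_lt (by fun_prop) (by fun_prop)
  have h3 : MeasurableSet {x : En n × En n |
      ‖(1 : ℂ) - inner ℂ x.1 x.2‖ ^ 2 ≤ M * ((1 - ‖x.1‖ ^ 2) * (1 - ‖x.2‖ ^ 2))} :=
    measurableSet_le (Continuous.measurable (by fun_prop)) (Continuous.measurable (by fun_prop))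
  exact h1.inter (h2.inter h3)

lemma rel_meas_right {n : ℕ} (M : ℝ) (z : En n) : MeasurableSet {w | rel M z w} :=
  (measurable_prodMk_left (x := z)) (rel_meas n M)

/-- `|f|^p` cut off to the ball. -/
def Fp {n : ℕ} (p : ℝ) (f : En n → ℂ) : En n → ℝ≥0∞ :=
  (uball n).indicator (fun z => ‖f z‖ₑ ^ p)

lemma Fp_meas {n : ℕ} {p : ℝ} (hp : 1 < p) {f : En n → ℂ} (hf : DifferentiableOn ℂ f (uball n)) :
    Measurable (Fp p f) := by
  apply meas_ind Metric.isOpen_ball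
  exact (ENNReal.continuous_rpow_const (y := p)).comp_continuousOn hf.continuousOn.enorm

lemma comp_hasFDerivAt {n : ℕ} {f : En n → ℂ} (hf : DifferentiableOn ℂ f (uball n)) {w : En n}
    (hw : ‖w‖ < 1) {m : En n → En n} {L : En n →L[ℂ] En n} (hm : HasFDerivAt m L 0)
    (h0 : m 0 = w) : HasFDerivAt (f ∘ m) ((fderiv ℂ f w).comp L) 0 := by
  have h1 : HasFDerivAt f (fderiv ℂ f w) (m 0) := by
    rw [h0]
    exact (hf.differentiableAt (Metric.isOpen_ball.mem_nhds (mem_uball.2 hw))).hasFDerivAt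
  exact h1.comp 0 hm

lemma aff_hasFDerivAt {n : ℕ} (w u : En n) : HasFDerivAt (fun u => w + Lm w u) (Lm w) u := by
  simpa using (Lm w).hasFDerivAt.const_add w

lemma invGrad_eq {n : ℕ} {f : En n → ℂ} (hf : DifferentiableOn ℂ f (uball n)) {w : En n}
    (hw : ‖w‖ < 1) : invGradArea f w = ‖(fderiv ℂ f w).comp (Lm w)‖ := by
  unfold invGradArea
  rw [(comp_hasFDerivAt hf hw (mobius_hasFDerivAt hw) (mobius_zero w)).fderiv]
  rw [ContinuousLinearMap.comp_neg, norm_neg]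

lemma grad_le {n : ℕ} {f : En n → ℂ} (hf : DifferentiableOn ℂ f (uball n)) {w : En n}
    (hw : ‖w‖ < 1) : gradArea f w ≤ 2 * invGradArea f w := by
  rw [invGrad_eq hf hw]
  unfold gradArea
  have hs := sq1_pos hw
  have hs1 := sq1_le (z := w)
  have hs2 := sq1_sq hw
  have hw' := one_sub_sq_pos hw
  rw [← le_div_iff₀' hw']
  refine ContinuousLinearMap.opNorm_le_bound _ (by positivity) ?_
  intro v
  obtain ⟨u, hu, hu2⟩ := Lm_inv hw v
  have h1 : fderiv ℂ f w v = ((fderiv ℂ f w).comp (Lm w)) u := by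
    rw [ContinuousLinearMap.comp_apply, hu]
  have h2 : ‖u‖ ≤ 2 / (1 - ‖w‖ ^ 2) * ‖v‖ := by
    refine hu2.trans ?_
    have h3 : ‖(inner ℂ w v : ℂ)‖ ≤ ‖v‖ := by
      refine (norm_inner_le_norm (𝕜 := ℂ) w v).trans ?_
      exact mul_le_of_le_one_left (norm_nonneg _) hw.le
    have h4 : ‖v‖ / sq1 w ≤ ‖v‖ / (1 - ‖w‖ ^ 2) := by
      apply div_le_div_of_nonneg_left (norm_nonneg _) hw'
      rw [← hs2]; nlinarith
    calc _ ≤ ‖v‖ / (1 - ‖w‖ ^ 2) + ‖v‖ / (1 - ‖w‖ ^ 2) := by gcongr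
      _ = _ := by ring
  rw [h1]
  calc _ ≤ ‖(fderiv ℂ f w).comp (Lm w)‖ * ‖u‖ := ContinuousLinearMap.le_opNorm _ _
    _ ≤ ‖(fderiv ℂ f w).comp (Lm w)‖ * (2 / (1 - ‖w‖ ^ 2) * ‖v‖) := by gcongr
    _ = _ := by ring

lemma rad_le {n : ℕ} {f : En n → ℂ} {w : En n} (hw : ‖w‖ < 1) : radArea f w ≤ gradArea f w := by
  unfold radArea gradArea radD
  have hw' := one_sub_sq_pos hw
  gcongr
  refine (ContinuousLinearMap.le_opNorm _ _).trans ?_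
  exact mul_le_of_le_one_right (norm_nonneg _) hw.le

lemma lintegral_aff {n : ℕ} {w : En n} (hw : ‖w‖ < 1) {ψ : En n → ℝ≥0∞} (hψ : Measurable ψ) :
    ∫⁻ u, ψ (w + Lm w u) ∂vol n =
      ENNReal.ofReal ((1 - ‖w‖ ^ 2) ^ (n + 1))⁻¹ * ∫⁻ x, ψ x ∂vol n := by
  have hw' := one_sub_sq_pos hw
  have hd := Lm_det hw
  have h1 := Measure.map_linearMap_addHaar_eq_smul_addHaar (vol n)
    (f := (Lm w : En n →ₗ[ℂ] En n).restrictScalars ℝ) (by rw [hd]; positivity)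
  rw [hd, abs_of_nonneg (by positivity)] at h1
  have h2 : Measure.map (Lm w) (vol n) = ENNReal.ofReal ((1 - ‖w‖ ^ 2) ^ (n + 1))⁻¹ • vol n := h1
  have h3 : ∫⁻ x, ψ (w + x) ∂(Measure.map (Lm w) (vol n)) = ∫⁻ u, ψ (w + Lm w u) ∂vol n :=
    lintegral_map (hψ.comp (measurable_const_add w)) (Lm w).continuous.measurable
  rw [← h3, h2, lintegral_smul_measure, lintegral_add_left_eq_self]
  rfl

lemma inv_bound (n : ℕ) {p : ℝ} (hp : 1 < p) : ∃ K : ℝ≥0∞, K ≠ ⊤ ∧ ∀ f : En n → ℂ,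
    DifferentiableOn ℂ f (uball n) → ∀ w : En n, ‖w‖ < 1 →
    ENNReal.ofReal (invGradArea f w) ^ p ≤ K * (ENNReal.ofReal ((1 - ‖w‖ ^ 2) ^ (n + 1))⁻¹ *
      ∫⁻ x in {x | rel 16 w x}, Fp p f x ∂vol n) := by
  obtain ⟨K, hK, hh⟩ := fderiv_mean_p n hp
  refine ⟨K, hK, ?_⟩
  intro f hf w hw
  have hmem : ∀ u ∈ Metric.ball (0 : En n) (1 / 4), rel 16 w (w + Lm w u) := by
    intro u hu
    rw [mem_ball_zero_iff] at hu
    exact Lm_rel hw hu.le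
  have h1 := hh (f ∘ fun u => w + Lm w u) (by
    refine hf.comp (fun u _ => (aff_hasFDerivAt w u).differentiableAt.differentiableWithinAt) ?_
    intro u hu
    exact mem_uball.2 (hmem u hu).2.1)
  rw [(comp_hasFDerivAt hf hw (aff_hasFDerivAt w 0) (by simp)).fderiv] at h1
  rw [invGrad_eq hf hw, ofReal_norm]
  refine h1.trans ?_
  gcongr
  rw [← lintegral_indicator (rel_meas_right 16 w),
    ← lintegral_aff hw ((Fp_meas hp hf).indicator (rel_meas_right 16 w)),
    ← lintegral_indicator Metric.isOpen_ball.measurableSet]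
  apply lintegral_mono
  intro u
  by_cases hu : u ∈ Metric.ball (0 : En n) (1 / 4)
  · have := hmem u hu
    simp only [Set.indicator_of_mem hu]
    rw [Set.indicator_of_mem (show w + Lm w u ∈ {x | rel 16 w x} from this), Fp,
      Set.indicator_of_mem (mem_uball.2 this.2.1)]
    rfl
  · simp only [Set.indicator_of_notMem hu]
    exact zero_le

/-- averaged function. -/
def Sf {n : ℕ} (M p : ℝ) (f : En n → ℂ) (z : En n) : ℝ≥0∞ :=
  ENNReal.ofReal ((1 - ‖z‖ ^ 2) ^ (n + 1))⁻¹ * ∫⁻ x in {x | rel M z x}, Fp p f x ∂vol n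

lemma inv_comp {n : ℕ} {M : ℝ} (hM : 0 < M) {z w : En n} (h : rel M z w) :
    ((1 - ‖w‖ ^ 2) ^ (n + 1))⁻¹ ≤ (4 * M) ^ (n + 1) * ((1 - ‖z‖ ^ 2) ^ (n + 1))⁻¹ := by
  have c := rel_comp h
  have hz := one_sub_sq_pos h.1
  have hw := one_sub_sq_pos h.2.1
  rw [← div_eq_mul_inv, inv_eq_one_div, div_le_div_iff₀ (by positivity) (by positivity), one_mul,
    ← mul_pow]
  gcongr

lemma inv_bound2 (n : ℕ) {p M : ℝ} (hp : 1 < p) (hM : 0 < M) : ∃ K : ℝ≥0∞, K ≠ ⊤ ∧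
    ∃ M' : ℝ, 0 < M' ∧ ∀ f : En n → ℂ,
    DifferentiableOn ℂ f (uball n) → ∀ z w : En n, rel M z w →
    ENNReal.ofReal (invGradArea f w) ^ p ≤ K * Sf M' p f z := by
  obtain ⟨K, hK, h⟩ := inv_bound n hp
  refine ⟨K * ENNReal.ofReal ((4 * M) ^ (n + 1)), ENNReal.mul_ne_top hK ENNReal.ofReal_ne_top,
    (8 * M + 4 * 16) ^ 2 * (4 * M) * (4 * 16), by positivity, ?_⟩
  intro f hf z w hr
  refine (h f hf w hr.2.1).trans ?_
  unfold Sf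
  rw [mul_assoc]
  refine mul_le_mul' le_rfl ?_
  rw [← mul_assoc, ← ENNReal.ofReal_mul (by positivity)]
  exact mul_le_mul' (ENNReal.ofReal_le_ofReal (inv_comp hM hr))
    (lintegral_mono_set fun x hx => rel_trans hM.le (by norm_num) hr hx)

lemma tau_bound (n : ℕ) {M : ℝ} (hM : 0 < M) : ∃ T : ℝ≥0∞, T ≠ ⊤ ∧ ∀ z : En n, ‖z‖ < 1 →
    measTau n {w | rel M z w} ≤ T := by
  refine ⟨ENNReal.ofReal ((4 * M) ^ (n + 1)) * vol n (Metric.closedBall 0 (Real.sqrt (4 * M + 3) + (2 * M + 1))), ENNReal.mul_ne_top ENNReal.ofReal_ne_top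
    measure_closedBall_lt_top.ne, ?_⟩
  intro z hz
  have hz' := one_sub_sq_pos hz
  unfold measTau
  rw [withDensity_apply _ (rel_meas_right M z)]
  calc _ ≤ ∫⁻ w in {w | rel M z w}, ENNReal.ofReal
          ((4 * M) ^ (n + 1) * ((1 - ‖z‖ ^ 2) ^ (n + 1))⁻¹) ∂(vol n).restrict (uball n) := by
        apply setLIntegral_mono' (rel_meas_right M z)
        intro w hw
        apply ENNReal.ofReal_le_ofReal
        refine le_trans (le_of_eq ?_) (inv_comp hM hw)
        rw [Real.rpow_neg (one_sub_sq_pos hw.2.1).le]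
        congr 1
        have e := Real.rpow_natCast (1 - ‖w‖ ^ 2) (n + 1)
        rw [← e, Nat.cast_add, Nat.cast_one]
    _ ≤ ENNReal.ofReal ((4 * M) ^ (n + 1) * ((1 - ‖z‖ ^ 2) ^ (n + 1))⁻¹) *
          vol n {w | rel M z w} := by
        rw [setLIntegral_const]
        gcongr
        exact Measure.restrict_le_self
    _ ≤ ENNReal.ofReal ((4 * M) ^ (n + 1) * ((1 - ‖z‖ ^ 2) ^ (n + 1))⁻¹) *
          (ENNReal.ofReal ((1 - ‖z‖ ^ 2) ^ (n + 1)) *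
      vol n (Metric.closedBall 0 (Real.sqrt (4 * M + 3) + (2 * M + 1)))) := by
        gcongr
        exact rel_vol hM.le hz
    _ = _ := by
        rw [← mul_assoc, ← ENNReal.ofReal_mul (by positivity), inv_mul_cancel_right₀ (by positivity)]

lemma area_bound (n : ℕ) {p q γ : ℝ} (hp : 1 < p) (hq : 1 < q) : ∃ K : ℝ≥0∞, K ≠ ⊤ ∧
    ∃ M' : ℝ, 0 < M' ∧ ∀ f : En n → ℂ,
    DifferentiableOn ℂ f (uball n) → ∀ g : En n → ℝ,
    (∀ w, ‖w‖ < 1 → g w ≤ 2 * invGradArea f w) → ∀ z : En n, ‖z‖ < 1 →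
    areaF γ q g z ^ p ≤ K * Sf M' p f z := by
  set M := Real.exp (2 * γ) with hMdef
  have hM : 0 < M := Real.exp_pos _
  obtain ⟨K, hK, M', hM', h⟩ := inv_bound2 n hp hM
  obtain ⟨T, hT, hTb⟩ := tau_bound n hM
  have hp0 : 0 < p := by linarith
  have hq0 : 0 < q := by linarith
  refine ⟨2 ^ p * (T ^ (1 / q)) ^ p * K, ?_, M', hM', ?_⟩
  · refine ENNReal.mul_ne_top (ENNReal.mul_ne_top ?_ ?_) hK
    · exact ENNReal.rpow_ne_top_of_nonneg hp0.le (by norm_num)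
    · exact ENNReal.rpow_ne_top_of_nonneg hp0.le
        (ENNReal.rpow_ne_top_of_nonneg (by positivity) hT)
  intro f hf g hg z hz
  set B := 2 * (K * Sf M' p f z) ^ (1 / p) with hB
  have h1 : ∀ w, rel M z w → ENNReal.ofReal (g w) ≤ B := by
    intro w hw
    refine (ENNReal.ofReal_le_ofReal (hg w hw.2.1)).trans ?_
    rw [ENNReal.ofReal_mul (by norm_num), ENNReal.ofReal_ofNat, hB]
    gcongr
    rw [one_div, ENNReal.le_rpow_inv_iff hp0]
    exact h f hf z w hw
  have h2 : areaF γ q g z ≤ B * T ^ (1 / q) := by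
    unfold areaF
    calc _ ≤ (∫⁻ w in {w | rel M z w}, ENNReal.ofReal (g w) ^ q ∂measTau n) ^ (1 / q) := by
          gcongr
          exact fun w hw => Dball_rel hz hw
      _ ≤ (∫⁻ w in {w | rel M z w}, B ^ q ∂measTau n) ^ (1 / q) := by
          refine ENNReal.rpow_le_rpow ?_ (by positivity)
          apply setLIntegral_mono' (rel_meas_right M z)
          intro w hw
          exact ENNReal.rpow_le_rpow (h1 w hw) hq0.le
      _ ≤ (B ^ q * T) ^ (1 / q) := by
          rw [setLIntegral_const]
          gcongr
          exact hTb z hz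
      _ = _ := by
          rw [ENNReal.mul_rpow_of_nonneg _ _ (by positivity), ← ENNReal.rpow_mul,
            mul_one_div_cancel hq0.ne', ENNReal.rpow_one]
  refine (ENNReal.rpow_le_rpow h2 hp0.le).trans_eq ?_
  rw [hB, ENNReal.mul_rpow_of_nonneg _ _ hp0.le, ENNReal.mul_rpow_of_nonneg _ _ hp0.le,
    ← ENNReal.rpow_mul _ (1 / p), one_div_mul_cancel hp0.ne', ENNReal.rpow_one]
  ring

lemma rpow_comp {x y K a : ℝ} (hx : 0 < x) (hy : 0 < y) (hK : 0 < K) (h1 : x ≤ K * y)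
    (h2 : y ≤ K * x) : x ^ a ≤ K ^ |a| * y ^ a := by
  rcases le_total 0 a with ha | ha
  · rw [abs_of_nonneg ha, ← Real.mul_rpow hK.le hy.le]
    exact Real.rpow_le_rpow hx.le h1 ha
  · rw [abs_of_nonpos ha, Real.rpow_neg hK.le, ← Real.inv_rpow hK.le,
      ← Real.mul_rpow (by positivity) hy.le]
    apply Real.rpow_le_rpow_of_nonpos (by positivity) _ ha
    rw [inv_mul_le_iff₀ hK]; exact h2

lemma fubini_bound (n : ℕ) {p α M : ℝ} (hp : 1 < p) (hα : -1 < α) (hM : 0 < M) :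
    ∃ K : ℝ≥0∞, K ≠ ⊤ ∧ ∀ f : En n → ℂ, DifferentiableOn ℂ f (uball n) →
    ∫⁻ z, Sf M p f z ∂measA n α ≤ K * ∫⁻ z, ENNReal.ofReal (‖f z‖ ^ p) ∂measA n α := by
  have hc : 0 ≤ cnorm n α := by
    unfold cnorm
    rw [if_pos hα]
    have h1 : 0 < Real.Gamma (n + α + 1) := by
      apply Real.Gamma_pos_of_pos
      have : (0 : ℝ) ≤ n := Nat.cast_nonneg n
      linarith
    have h2 : 0 < Real.Gamma (α + 1) := Real.Gamma_pos_of_pos (by linarith)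
    positivity
  set V := vol n (Metric.closedBall 0 (Real.sqrt (4 * M + 3) + (2 * M + 1))) with hV
  have hVt : V ≠ ⊤ := measure_closedBall_lt_top.ne
  refine ⟨ENNReal.ofReal ((4 * M) ^ |α| * (4 * M) ^ (n + 1)) * V,
    ENNReal.mul_ne_top ENNReal.ofReal_ne_top hVt, ?_⟩
  intro f hf
  have hFm := Fp_meas hp hf
  set D : En n → ℝ≥0∞ := fun z => ENNReal.ofReal (cnorm n α * (1 - ‖z‖ ^ 2) ^ α) with hD
  have hDm : Measurable D := by
    rw [hD]
    fun_prop
  set a : En n → ℝ≥0∞ := fun z => D z * ENNReal.ofReal ((1 - ‖z‖ ^ 2) ^ (n + 1))⁻¹ with ha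
  have ham : Measurable a := by
    rw [ha]
    fun_prop
  have hcomp : ∀ z x : En n, rel M z x →
      a z ≤ ENNReal.ofReal ((4 * M) ^ |α| * (4 * M) ^ (n + 1)) * a x := by
    intro z x hr
    have hz := one_sub_sq_pos hr.1
    have hx := one_sub_sq_pos hr.2.1
    simp only [ha, hD]
    rw [← ENNReal.ofReal_mul (by positivity), ← ENNReal.ofReal_mul (by positivity),
      ← ENNReal.ofReal_mul (by positivity)]
    apply ENNReal.ofReal_le_ofReal
    have e1 := rpow_comp (a := α) hz hx (by positivity) (rel_comp hr) (rel_comp (rel_symm hr))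
    have e2 := inv_comp hM (rel_symm hr)
    calc _ ≤ cnorm n α * ((4 * M) ^ |α| * (1 - ‖x‖ ^ 2) ^ α) *
          ((4 * M) ^ (n + 1) * ((1 - ‖x‖ ^ 2) ^ (n + 1))⁻¹) := by gcongr
      _ = _ := by ring
  set H : En n → En n → ℝ≥0∞ := fun z x =>
    ({y : En n × En n | rel M y.1 y.2}).indicator (fun y => a y.1 * Fp p f y.2) (z, x) with hH
  have hHm : Measurable (Function.uncurry H) := by
    have : Function.uncurry H = ({y : En n × En n | rel M y.1 y.2}).indicator
        (fun y => a y.1 * Fp p f y.2) := by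
      funext ⟨z, x⟩; rfl
    rw [this]
    exact Measurable.indicator ((ham.comp measurable_fst).mul (hFm.comp measurable_snd)) (rel_meas n M)
  have hin : ∀ x, ∫⁻ z, H z x ∂vol n ≤
      ENNReal.ofReal ((4 * M) ^ |α| * (4 * M) ^ (n + 1)) * V * (D x * Fp p f x) := by
    intro x
    by_cases hx : ‖x‖ < 1
    · have hx' := one_sub_sq_pos hx
      have hle : ∀ z, H z x ≤ ({z | rel M x z}).indicator (fun _ =>
          ENNReal.ofReal ((4 * M) ^ |α| * (4 * M) ^ (n + 1)) * a x * Fp p f x) z := by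
        intro z
        simp only [hH]
        by_cases hr : rel M z x
        · rw [Set.indicator_of_mem (show (z, x) ∈ {y : En n × En n | rel M y.1 y.2} from hr),
            Set.indicator_of_mem (show z ∈ {z | rel M x z} from rel_symm hr)]
          have := hcomp z x hr
          gcongr
        · rw [Set.indicator_of_notMem (show (z, x) ∉ {y : En n × En n | rel M y.1 y.2} from hr)]
          exact zero_le
      refine (lintegral_mono hle).trans ?_
      rw [lintegral_indicator (rel_meas_right M x), setLIntegral_const]
      refine (mul_le_mul_right (rel_vol hM.le hx) _).trans_eq ?_
      have e : ENNReal.ofReal ((1 - ‖x‖ ^ 2) ^ (n + 1))⁻¹ *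
          ENNReal.ofReal ((1 - ‖x‖ ^ 2) ^ (n + 1)) = 1 := by
        rw [← ENNReal.ofReal_mul (by positivity), inv_mul_cancel₀ (by positivity),
          ENNReal.ofReal_one]
      simp only [ha]
      calc _ = ENNReal.ofReal ((4 * M) ^ |α| * (4 * M) ^ (n + 1)) * V * (D x * Fp p f x) *
          (ENNReal.ofReal ((1 - ‖x‖ ^ 2) ^ (n + 1))⁻¹ *
          ENNReal.ofReal ((1 - ‖x‖ ^ 2) ^ (n + 1))) := by ring
        _ = _ := by rw [e, mul_one]
    · have : ∀ z, H z x = 0 := by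
        intro z
        simp only [hH]
        exact Set.indicator_of_notMem (fun hr => hx hr.2.1) _
      simp [this]
  calc ∫⁻ z, Sf M p f z ∂measA n α
      ≤ ∫⁻ z in uball n, (D * Sf M p f) z ∂vol n :=
        lintegral_withDensity_le_lintegral_mul _ hDm _
    _ ≤ ∫⁻ z, (D * Sf M p f) z ∂vol n := setLIntegral_le_lintegral _ _
    _ = ∫⁻ z, (∫⁻ x, H z x ∂vol n) ∂vol n := by
        congr 1
        funext z
        simp only [Pi.mul_apply, Sf]
        rw [← lintegral_indicator (rel_meas_right M z), ← mul_assoc,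
          ← lintegral_const_mul _ (hFm.indicator (rel_meas_right M z))]
        congr 1
        funext x
        simp only [hH]
        by_cases hr : rel M z x
        · rw [Set.indicator_of_mem (show (z, x) ∈ {y : En n × En n | rel M y.1 y.2} from hr),
            Set.indicator_of_mem (show x ∈ {x | rel M z x} from hr)]
        · rw [Set.indicator_of_notMem (show (z, x) ∉ {y : En n × En n | rel M y.1 y.2} from hr),
            Set.indicator_of_notMem (show x ∉ {x | rel M z x} from hr), mul_zero]
    _ = ∫⁻ x, (∫⁻ z, H z x ∂vol n) ∂vol n := lintegral_lintegral_swap hHm.aemeasurable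
    _ ≤ ∫⁻ x, ENNReal.ofReal ((4 * M) ^ |α| * (4 * M) ^ (n + 1)) * V * (D x * Fp p f x) ∂vol n :=
        lintegral_mono hin
    _ = ENNReal.ofReal ((4 * M) ^ |α| * (4 * M) ^ (n + 1)) * V * ∫⁻ x, D x * Fp p f x ∂vol n :=
        lintegral_const_mul _ (hDm.mul hFm)
    _ ≤ _ := by
        refine mul_le_mul' le_rfl ?_
        calc ∫⁻ x, D x * Fp p f x ∂vol n = ∫⁻ x in uball n, (D * Fp p f) x ∂vol n := by
              rw [← lintegral_indicator (show MeasurableSet (uball n) from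
                Metric.isOpen_ball.measurableSet)]
              congr 1
              funext x
              by_cases hx : x ∈ uball n
              · rw [Set.indicator_of_mem hx]; rfl
              · rw [Set.indicator_of_notMem hx, Fp, Set.indicator_of_notMem hx, mul_zero]
          _ = ∫⁻ x, Fp p f x ∂measA n α :=
              (lintegral_withDensity_eq_lintegral_mul _ hDm hFm).symm
          _ ≤ _ := by
              apply lintegral_mono
              intro x
              refine (Set.indicator_le_self _ _ x).trans_eq ?_
              rw [← ofReal_norm, ENNReal.ofReal_rpow_of_nonneg (norm_nonneg _) (by linarith)]

lemma main_bound (n : ℕ) {γ α q p : ℝ} (hα : -1 < α) (hq : 1 < q) (hp : 1 < p) :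
    ∃ C : ℝ≥0∞, 0 < C ∧ C < ⊤ ∧ ∀ f : En n → ℂ, DifferentiableOn ℂ f (uball n) →
      ∀ g : En n → ℝ, (∀ w, ‖w‖ < 1 → g w ≤ 2 * invGradArea f w) →
      (∫⁻ z, (areaF γ q g z) ^ p ∂measA n α) ^ (1 / p) ≤ C * apnorm n p α f := by
  obtain ⟨K, hK, M, hM, h1⟩ := area_bound n (γ := γ) hp hq
  obtain ⟨K', hK', h2⟩ := fubini_bound n hp hα hM
  have hp0 : 0 < p := by linarith
  refine ⟨(K * K') ^ (1 / p) + 1, by positivity, ?_, ?_⟩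
  · rw [ENNReal.add_lt_top]
    exact ⟨(ENNReal.rpow_ne_top_of_nonneg (by positivity) (ENNReal.mul_ne_top hK hK')).lt_top,
      ENNReal.one_lt_top⟩
  intro f hf g hg
  have hae : ∀ᵐ z ∂measA n α, ‖z‖ < 1 := by
    have h3 : ∀ᵐ z ∂(vol n).restrict (uball n), z ∈ uball n :=
      ae_restrict_mem Metric.isOpen_ball.measurableSet
    have h4 := (withDensity_absolutelyContinuous ((vol n).restrict (uball n))
      (fun z => ENNReal.ofReal (cnorm n α * (1 - ‖z‖ ^ 2) ^ α))).ae_le h3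
    filter_upwards [h4] with z hz
    exact mem_uball.1 hz
  have h5 : ∫⁻ z, (areaF γ q g z) ^ p ∂measA n α ≤
      K * K' * ∫⁻ z, ENNReal.ofReal (‖f z‖ ^ p) ∂measA n α := by
    calc _ ≤ ∫⁻ z, K * Sf M p f z ∂measA n α := by
          apply lintegral_mono_ae
          filter_upwards [hae] with z hz
          exact h1 f hf g hg z hz
      _ = K * ∫⁻ z, Sf M p f z ∂measA n α := lintegral_const_mul' _ _ hK
      _ ≤ K * (K' * ∫⁻ z, ENNReal.ofReal (‖f z‖ ^ p) ∂measA n α) := by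
          gcongr
          exact h2 f hf
      _ = _ := by ring
  refine (ENNReal.rpow_le_rpow h5 (by positivity)).trans ?_
  rw [ENNReal.mul_rpow_of_nonneg _ _ (by positivity)]
  unfold apnorm
  gcongr
  exact le_self_add

/-- `L^p`-boundedness of the radial, gradient and invariant-gradient area
integral operators on Bergman spaces. -/
theorem stmt19 (n : ℕ) (hn : 1 ≤ n) (γ α q p : ℝ) (hγ : 0 < γ) (hα : -1 < α)
    (hq : 1 < q) (hp : 1 < p) :
    ∃ C : ℝ≥0∞, 0 < C ∧ C < ⊤ ∧
      ∀ f : En n → ℂ, DifferentiableOn ℂ f (uball n) → apnorm n p α f < ⊤ →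
        (∫⁻ z, (areaF γ q (radArea f) z) ^ p ∂measA n α) ^ (1 / p) ≤ C * apnorm n p α f ∧
        (∫⁻ z, (areaF γ q (gradArea f) z) ^ p ∂measA n α) ^ (1 / p) ≤ C * apnorm n p α f ∧
        (∫⁻ z, (areaF γ q (invGradArea f) z) ^ p ∂measA n α) ^ (1 / p) ≤
          C * apnorm n p α f := by
  obtain ⟨C, h0, h1, h⟩ := main_bound n (γ := γ) hα hq hp
  refine ⟨C, h0, h1, fun f hf _ => ⟨h f hf _ fun w hw => ?_, h f hf _ fun w hw => ?_,
    h f hf _ fun w hw => ?_⟩⟩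
  · exact (rad_le hw).trans (grad_le hf hw)
  · exact grad_le hf hw
  · have : 0 ≤ invGradArea f w := norm_nonneg _
    linarith
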